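/- Let K ⊆ ℝⁿ be a basic closed semi-algebraic set with nonempty interior, defined by polynomials g_1,…,g_m, with quadratic module Q(g). If a polynomial f is nonnegative on K, then for every ε > 0 there exists d ∈ ℕ such that the polynomial f(x) + ε·(1 + Σ_{i=1}^n Σ_{k=1}^d x_i^{2k}/(2k)!) belongs to the w-norm-closure of Q(g). (Conversely, any f with this property is nonnegative on K.) -/

import Mathlib

open MvPolynomial

/-- The weight `w_α = (2⌈|α|/2⌉)!`. -/
def wt {n : ℕ} (α : Fin n →₀ ℕ) : ℕ :=
  (2 * (((α.sum fun _ e => e) + 1) / 2)).factorial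

/-- The weighted ℓ₁-norm `‖f‖_w = ∑_α w_α |f_α|`. -/
def wnorm {n : ℕ} (f : MvPolynomial (Fin n) ℝ) : ℝ :=
  ∑ α ∈ f.support, (wt α : ℝ) * |f.coeff α|

/-- A polynomial is a sum of squares. -/
def IsSOS {n : ℕ} (σ : MvPolynomial (Fin n) ℝ) : Prop :=
  ∃ (k : ℕ) (p : Fin k → MvPolynomial (Fin n) ℝ), σ = ∑ i, (p i) ^ 2

/-- Membership in the quadratic module `Q(g) = {σ₀ + ∑ⱼ σⱼ gⱼ : σⱼ ∈ Σ[x]}`. -/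
def memQM {n m : ℕ} (g : Fin m → MvPolynomial (Fin n) ℝ)
    (f : MvPolynomial (Fin n) ℝ) : Prop :=
  ∃ (σ₀ : MvPolynomial (Fin n) ℝ) (σ : Fin m → MvPolynomial (Fin n) ℝ),
    IsSOS σ₀ ∧ (∀ j, IsSOS (σ j)) ∧ f = σ₀ + ∑ j, σ j * g j

/-- The perturbation polynomial `1 + ∑_{i=1}^n ∑_{k=1}^d x_i^{2k}/(2k)!`. -/
noncomputable def pert (n d : ℕ) : MvPolynomial (Fin n) ℝ :=
  1 + ∑ i : Fin n, ∑ k ∈ Finset.Icc 1 d,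
    C (((2 * k).factorial : ℝ))⁻¹ * X i ^ (2 * k)

universe u

theorem exists_commCStarAlgebra_hom {A : Type u} [CStarAlgebra A] (s : Set A)
    (hcomm : ∀ x ∈ s, ∀ y ∈ s, x * y = y * x)
    (hcomm_star : ∀ a ∈ s, ∀ b ∈ s, a * star b = star b * a) :
    ∃ (B : Type u) (_ : CommCStarAlgebra B) (φ : B →⋆ₐ[ℂ] A), ∀ a ∈ s, ∃ b, φ b = a := by
  let S := (StarAlgebra.adjoin ℂ s).topologicalClosure
  have hS : IsClosed (S : Set A) := StarSubalgebra.isClosed_topologicalClosure _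
  have hadj := StarAlgebra.isMulCommutative_adjoin ℂ hcomm hcomm_star
  let _ : CStarAlgebra S := StarSubalgebra.cstarAlgebra S (h_closed := hS)
  let cr : CommRing S := StarSubalgebra.commRingTopologicalClosure (StarAlgebra.adjoin ℂ s)
    (fun x y => hadj.is_comm.comm x y)
  let _ : CommCStarAlgebra S :=
    { (inferInstance : CStarAlgebra S) with mul_comm := fun x y => cr.mul_comm x y }
  refine ⟨S, inferInstance, S.subtype, fun a ha => ⟨⟨a, ?_⟩, rfl⟩⟩
  exact StarSubalgebra.le_topologicalClosure _ (StarAlgebra.subset_adjoin ℂ s ha)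

theorem exists_star_mul_self_eq_aeval {n : ℕ} {B : Type*} [CommCStarAlgebra B] (s : Fin n → B)
    (hs : ∀ j, IsSelfAdjoint (s j)) (f : MvPolynomial (Fin n) ℝ) (hf : ∀ x, 0 ≤ eval x f) :
    ∃ c : B, aeval s (map Complex.ofRealHom f) = star c * c := by
  let Φ := gelfandStarTransform B
  set F := Φ (aeval s (map Complex.ofRealHom f)) with hF
  have key : ∀ ω, 0 ≤ (F ω).re ∧ (F ω).im = 0 := by
    intro ω
    have h1 : ∀ j, ((ω (s j)).re : ℂ) = ω (s j) := fun j => by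
      have := (hs j).map ω
      exact Complex.conj_eq_iff_re.mp this
    have h2 : F ω = ((eval (fun j => (ω (s j)).re) f : ℝ) : ℂ) := by
      have e1 : F ω = ω (aeval s (map Complex.ofRealHom f)) := rfl
      have e2 : ω (aeval s (map Complex.ofRealHom f))
          = aeval (fun j => ω (s j)) (map Complex.ofRealHom f) := by
        have := MvPolynomial.comp_aeval_apply s (WeakDual.CharacterSpace.toAlgHom ω)
          (map Complex.ofRealHom f)
        exact this
      rw [e1, e2, show (fun j => ω (s j)) = fun j => (((ω (s j)).re : ℝ) : ℂ) from
        funext fun j => (h1 j).symm]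
      rw [aeval_eq_eval, eval_map]
      exact (eval₂_comp_left Complex.ofRealHom (RingHom.id ℝ) _ f).symm
    rw [h2]
    exact ⟨by simpa using hf _, by simp⟩
  let G : C(WeakDual.characterSpace ℂ B, ℂ) :=
    ⟨fun ω => ((Real.sqrt (F ω).re : ℝ) : ℂ), by fun_prop⟩
  refine ⟨Φ.symm G, (EquivLike.injective Φ) ?_⟩
  rw [map_mul, map_star, StarAlgEquiv.apply_symm_apply]
  ext ω
  have : F ω = ((F ω).re : ℂ) := Complex.ext rfl (by simp [(key ω).2])
  change F ω = star (G ω) * G ω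
  rw [this]
  simp only [G, ContinuousMap.coe_mk, Complex.star_def, Complex.conj_ofReal]
  rw [← Complex.ofReal_mul, Real.mul_self_sqrt (key ω).1]

/-- A dense linear map from complex polynomials to a Hilbert space for which multiplication by the
variables is symmetric, every vector being analytic for each pair of variables. -/
structure IsAnalyticRep {n : ℕ} {H : Type*} [NormedAddCommGroup H] [InnerProductSpace ℂ H]
    (ι : MvPolynomial (Fin n) ℂ →ₗ[ℂ] H) (ρ : ℝ) : Prop where
  pos : 0 < ρ
  dense : DenseRange ι
  symm : ∀ j p q, inner ℂ (ι (X j * p)) (ι q) = inner ℂ (ι p) (ι (X j * q))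
  bound : ∀ p, ∃ C, ∀ i j k l,
    ‖ι (X i ^ k * X j ^ l * p)‖ ≤ C * ρ ^ (k + l) * (k + l).factorial

theorem mem_ball_zero_inv_iff {ρ : ℝ} (hρ : 0 < ρ) (y : ℝ) :
    y ∈ Metric.ball (0 : ℝ) (2 * ρ)⁻¹ ↔ 2 * ρ * |y| < 1 := by
  rw [mem_ball_zero_iff, Real.norm_eq_abs, ← one_div, lt_div_iff₀ (by positivity), mul_comm]

section AnalyticRep

variable {n : ℕ} {H : Type*} [NormedAddCommGroup H] [InnerProductSpace ℂ H]
  [CompleteSpace H] (ι : MvPolynomial (Fin n) ℂ →ₗ[ℂ] H)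

/-- The `k`-th Taylor coefficient of `exp (i t)`. -/
noncomputable def expCoeff (t : ℝ) (k : ℕ) : ℂ := (Complex.I * t) ^ k / k.factorial

/-- The power series of `exp (i t X_j)` applied to a polynomial. -/
noncomputable def expSeries (j : Fin n) (t : ℝ) (p : MvPolynomial (Fin n) ℂ) : H :=
  ∑' k, expCoeff t k • ι (X j ^ k * p)

theorem norm_expCoeff (t : ℝ) (k : ℕ) : ‖expCoeff t k‖ = |t| ^ k / k.factorial := by
  simp [expCoeff]

theorem conj_expCoeff (t : ℝ) (k : ℕ) :
    (starRingEnd ℂ) (expCoeff t k) = expCoeff (-t) k := by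
  simp [expCoeff]

variable {ι} {ρ : ℝ} (hι : IsAnalyticRep ι ρ)
include hι

theorem IsAnalyticRep.summable_prod (i j : Fin n) {s t : ℝ} (hs : 2 * ρ * |s| < 1)
    (ht : 2 * ρ * |t| < 1) (p : MvPolynomial (Fin n) ℂ) :
    Summable fun x : ℕ × ℕ =>
      (expCoeff s x.1 * expCoeff t x.2) • ι (X i ^ x.1 * X j ^ x.2 * p) := by
  obtain ⟨C, hC⟩ := hι.bound p
  have hρ := hι.pos
  have hC0 : 0 ≤ C := by simpa using (norm_nonneg _).trans (hC i j 0 0)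
  have g1 : Summable fun k => (2 * ρ * |s|) ^ k :=
    summable_geometric_of_lt_one (by positivity) hs
  have g2 : Summable fun k => (2 * ρ * |t|) ^ k :=
    summable_geometric_of_lt_one (by positivity) ht
  have g := (g1.mul_of_nonneg g2 (fun _ => by positivity) (fun _ => by positivity)).mul_left C
  refine Summable.of_norm_bounded g fun ⟨k, l⟩ => ?_
  rw [norm_smul, norm_mul, norm_expCoeff, norm_expCoeff]
  have h1 : ((k + l).factorial : ℝ) ≤ 2 ^ (k + l) * (k.factorial * l.factorial) := by
    have h2 : (k + l).choose k * k.factorial * l.factorial = (k + l).factorial := by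
      simpa using Nat.choose_mul_factorial_mul_factorial (Nat.le_add_right k l)
    have h3 : (k + l).choose k ≤ 2 ^ (k + l) := Nat.choose_le_two_pow _ _
    rw [← h2]
    push_cast
    rw [mul_assoc]
    gcongr
    exact_mod_cast h3
  calc |s| ^ k / k.factorial * (|t| ^ l / l.factorial) * ‖ι (X i ^ k * X j ^ l * p)‖
      ≤ |s| ^ k / k.factorial * (|t| ^ l / l.factorial) *
        (C * ρ ^ (k + l) * (2 ^ (k + l) * (k.factorial * l.factorial))) := by
        gcongr
        exact (hC i j k l).trans (by gcongr)
    _ = C * ((2 * ρ * |s|) ^ k * (2 * ρ * |t|) ^ l) := by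
        field_simp
        ring

theorem IsAnalyticRep.summable (j : Fin n) {t : ℝ} (ht : 2 * ρ * |t| < 1)
    (p : MvPolynomial (Fin n) ℂ) : Summable fun k => expCoeff t k • ι (X j ^ k * p) := by
  have := (hι.summable_prod j j (s := 0) (by simp) ht p).comp_injective
    (i := fun k : ℕ => ((0 : ℕ), k)) (fun a b h => by simpa using h)
  refine this.congr fun k => ?_
  simp [expCoeff]

omit [CompleteSpace H] hι in
theorem expSeries_zero (j : Fin n) (p : MvPolynomial (Fin n) ℂ) :
    expSeries ι j 0 p = ι p := by
  rw [expSeries, tsum_eq_single 0]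
  · simp [expCoeff]
  · intro k hk
    simp [expCoeff, hk]

theorem IsAnalyticRep.expSeries_add (j : Fin n) {t : ℝ} (ht : 2 * ρ * |t| < 1)
    (p q : MvPolynomial (Fin n) ℂ) :
    expSeries ι j t (p + q) = expSeries ι j t p + expSeries ι j t q := by
  rw [expSeries, expSeries, expSeries, ← (hι.summable j ht p).tsum_add (hι.summable j ht q)]
  simp [mul_add]

omit [CompleteSpace H] hι in
theorem expSeries_smul (j : Fin n) (t : ℝ) (c : ℂ) (p : MvPolynomial (Fin n) ℂ) :
    expSeries ι j t (c • p) = c • expSeries ι j t p := by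
  rw [expSeries, expSeries, ← tsum_const_smul'']
  simp [smul_comm c]

theorem IsAnalyticRep.hasDerivAt_expSeries (j : Fin n) {t : ℝ} (ht : 2 * ρ * |t| < 1)
    (p : MvPolynomial (Fin n) ℂ) :
    HasDerivAt (fun τ => expSeries ι j τ p) (Complex.I • expSeries ι j t (X j * p)) t := by
  have hρ := hι.pos
  have hmem := mem_ball_zero_inv_iff hρ
  obtain ⟨C, hC⟩ := hι.bound (X j * p)
  let g' : ℕ → ℝ → H := fun k y =>
    Nat.casesOn k 0 fun k => (Complex.I * expCoeff y k) • ι (X j ^ k * (X j * p))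
  let u : ℕ → ℝ := fun k => Nat.casesOn k 0 fun k => C * (1 / 2) ^ k
  have hu : Summable u := by
    rw [← summable_nat_add_iff 1]
    exact (summable_geometric_of_lt_one (by norm_num) (by norm_num)).mul_left C
  have key := hasDerivAt_tsum_of_isPreconnected (g := fun k y => expCoeff y k • ι (X j ^ k * p))
    (g' := g') (u := u) (t := Metric.ball 0 (2 * ρ)⁻¹) (y₀ := t) (y := t) hu Metric.isOpen_ball
    (convex_ball _ _).isPreconnected
    ?_ ?_ ((hmem t).2 ht) (hι.summable j ht p) ((hmem t).2 ht)
  · refine key.congr_deriv ?_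
    have hs : Summable fun k => g' k t := by
      rw [← summable_nat_add_iff 1]
      simp only [g', mul_smul]
      exact (hι.summable j ht (X j * p)).const_smul _
    rw [hs.tsum_eq_zero_add, expSeries, ← tsum_const_smul'']
    simp [g', mul_smul]
  · intro k y _
    cases k with
    | zero => simpa [expCoeff, g'] using hasDerivAt_const y (ι p)
    | succ k =>
      have h1 : HasDerivAt (fun y : ℝ => Complex.I * (y : ℂ)) Complex.I y := by
        simpa using (Complex.ofRealCLM.hasDerivAt (x := y)).const_mul Complex.I
      have h2 : HasDerivAt (fun y : ℝ => expCoeff y (k + 1)) (Complex.I * expCoeff y k) y := by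
        refine ((h1.pow (k + 1)).div_const _).congr_deriv ?_
        rw [expCoeff, Nat.factorial_succ]
        have : ((k : ℂ) + 1) ≠ 0 := by exact_mod_cast Nat.succ_ne_zero k
        have : (k.factorial : ℂ) ≠ 0 := by exact_mod_cast k.factorial_ne_zero
        push_cast
        field_simp
      have h3 := h2.smul_const (ι (X j ^ (k + 1) * p))
      simpa only [g', pow_succ, mul_assoc] using h3
  · intro k y hy
    cases k with
    | zero => simp [g', u]
    | succ k =>
      simp only [g', u, norm_smul, norm_mul, Complex.norm_I, norm_expCoeff, one_mul]
      have h1 := hC j j 0 k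
      simp only [pow_zero, one_mul, zero_add] at h1
      have hy' := ((hmem y).1 hy)
      have hC0 : 0 ≤ C := by simpa using (norm_nonneg _).trans (hC j j 0 0)
      calc |y| ^ k / k.factorial * ‖ι (X j ^ k * (X j * p))‖
          ≤ |y| ^ k / k.factorial * (C * ρ ^ k * k.factorial) := by gcongr
        _ = C * (ρ * |y|) ^ k := by field_simp; ring
        _ ≤ C * (1 / 2) ^ k := by gcongr; linarith

theorem IsAnalyticRep.inner_expSeries_left (j : Fin n) {t : ℝ} (ht : 2 * ρ * |t| < 1)
    (p : MvPolynomial (Fin n) ℂ) (v : H) :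
    inner ℂ (expSeries ι j t p) v = ∑' k, expCoeff (-t) k * inner ℂ (ι (X j ^ k * p)) v := by
  have h := ((innerSL ℂ v).map_tsum (hι.summable j ht p))
  have h2 := congrArg (starRingEnd ℂ) h
  simp only [innerSL_apply_apply] at h2
  rw [expSeries, ← inner_conj_symm, h2, Complex.conj_tsum]
  simp [inner_smul_right, conj_expCoeff]

theorem IsAnalyticRep.inner_expSeries_right (j : Fin n) {t : ℝ} (ht : 2 * ρ * |t| < 1)
    (p : MvPolynomial (Fin n) ℂ) (v : H) :
    inner ℂ v (expSeries ι j t p) = ∑' k, expCoeff t k * inner ℂ v (ι (X j ^ k * p)) := by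
  have h := ((innerSL ℂ v).map_tsum (hι.summable j ht p))
  simp only [innerSL_apply_apply] at h
  rw [expSeries, h]
  simp [inner_smul_right]

omit [CompleteSpace H] in
theorem IsAnalyticRep.symm_pow (j : Fin n) (k : ℕ) (p q : MvPolynomial (Fin n) ℂ) :
    inner ℂ (ι (X j ^ k * p)) (ι q) = inner ℂ (ι p) (ι (X j ^ k * q)) := by
  induction k generalizing p q with
  | zero => simp
  | succ k ih => rw [pow_succ, mul_assoc, ih, hι.symm, ← mul_assoc, ← pow_succ', ← pow_succ]

theorem IsAnalyticRep.inner_expSeries_adjoint (j : Fin n) {t : ℝ} (ht : 2 * ρ * |t| < 1)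
    (p q : MvPolynomial (Fin n) ℂ) :
    inner ℂ (expSeries ι j t p) (ι q) = inner ℂ (ι p) (expSeries ι j (-t) q) := by
  rw [hι.inner_expSeries_left j ht, hι.inner_expSeries_right j (by simpa using ht)]
  simp [hι.symm_pow]

theorem IsAnalyticRep.inner_expSeries_symm (j : Fin n) {t : ℝ} (ht : 2 * ρ * |t| < 1)
    (p q : MvPolynomial (Fin n) ℂ) :
    inner ℂ (expSeries ι j t (X j * p)) (expSeries ι j t q) =
      inner ℂ (expSeries ι j t p) (expSeries ι j t (X j * q)) := by
  rw [hι.inner_expSeries_left j ht, hι.inner_expSeries_left j ht]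
  congr with k
  rw [hι.inner_expSeries_right j ht, hι.inner_expSeries_right j ht]
  congr with l
  rw [mul_left_comm, hι.symm, mul_left_comm]

theorem IsAnalyticRep.norm_expSeries (j : Fin n) {t : ℝ} (ht : 2 * ρ * |t| < 1)
    (p : MvPolynomial (Fin n) ℂ) : ‖expSeries ι j t p‖ = ‖ι p‖ := by
  have hρ := hι.pos
  let F : ℝ → ℂ := fun τ => inner ℂ (expSeries ι j τ p) (expSeries ι j τ p)
  have hF : ∀ τ, 2 * ρ * |τ| < 1 → HasDerivAt F 0 τ := fun τ hτ => by
    have h := hι.hasDerivAt_expSeries j hτ p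
    refine (h.inner ℂ h).congr_deriv ?_
    rw [inner_smul_left, inner_smul_right, hι.inner_expSeries_symm j hτ]
    simp
  have hmem := mem_ball_zero_inv_iff hρ
  have hconst : F t = F 0 :=
    Metric.isOpen_ball.is_const_of_deriv_eq_zero (convex_ball _ _).isPreconnected
      (fun τ hτ => (hF τ ((hmem τ).1 hτ)).differentiableAt.differentiableWithinAt)
      (fun τ hτ => (hF τ ((hmem τ).1 hτ)).deriv) ((hmem t).2 ht) ((hmem 0).2 (by simp))
  simp only [F, expSeries_zero, inner_self_eq_norm_sq_to_K] at hconst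
  have h2 : ‖expSeries ι j t p‖ ^ 2 = ‖ι p‖ ^ 2 := by exact_mod_cast hconst
  exact (sq_eq_sq₀ (norm_nonneg _) (norm_nonneg _)).1 h2

theorem IsAnalyticRep.exists_unitary (j : Fin n) {t : ℝ} (ht : 2 * ρ * |t| < 1) :
    ∃ U : H →L[ℂ] H, (∀ p, U (ι p) = expSeries ι j t p) ∧ ∀ v, ‖U v‖ ≤ ‖v‖ := by
  let E : MvPolynomial (Fin n) ℂ →ₗ[ℂ] H :=
    { toFun := expSeries ι j t
      map_add' := hι.expSeries_add j ht
      map_smul' := expSeries_smul j t }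
  have hE : ∀ p, ‖E p‖ ≤ 1 * ‖ι p‖ := fun p => by
    rw [one_mul]; exact (hι.norm_expSeries j ht p).le
  exact ⟨E.extendOfNorm ι, fun p => LinearMap.extendOfNorm_eq hι.dense ⟨1, hE⟩ p,
    fun v => by simpa using LinearMap.norm_extendOfNorm_apply_le hι.dense 1 hE v⟩

/-- The bounded operator `exp (i t X_j)`, for small `t`, and zero otherwise. -/
noncomputable def IsAnalyticRep.expOp (hι : IsAnalyticRep ι ρ) (j : Fin n) (t : ℝ) : H →L[ℂ] H :=
  open Classical in
  if ht : 2 * ρ * |t| < 1 then (hι.exists_unitary j ht).choose else 0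

theorem IsAnalyticRep.expOp_apply (j : Fin n) {t : ℝ} (ht : 2 * ρ * |t| < 1)
    (p : MvPolynomial (Fin n) ℂ) : hι.expOp j t (ι p) = expSeries ι j t p := by
  rw [expOp, dif_pos ht]
  exact (hι.exists_unitary j ht).choose_spec.1 p

theorem IsAnalyticRep.norm_expOp_apply_le (j : Fin n) (t : ℝ) (v : H) :
    ‖hι.expOp j t v‖ ≤ ‖v‖ := by
  rw [expOp]
  split_ifs with ht
  · exact (hι.exists_unitary j ht).choose_spec.2 v
  · simp

theorem IsAnalyticRep.star_expOp (j : Fin n) (t : ℝ) :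
    star (hι.expOp j t) = hι.expOp j (-t) := by
  by_cases ht : 2 * ρ * |t| < 1
  · have ht' : 2 * ρ * |-t| < 1 := by rwa [abs_neg]
    refine (ContinuousLinearMap.eq_adjoint_iff _ _).2 ?_ |>.symm
    have h1 : ∀ p q, inner ℂ (hι.expOp j (-t) (ι p)) (ι q) =
        inner ℂ (ι p) (hι.expOp j t (ι q)) := fun p q => by
      rw [hι.expOp_apply j ht, hι.expOp_apply j ht', hι.inner_expSeries_adjoint j ht', neg_neg]
    intro x y
    refine hι.dense.induction_on₂ (p := fun x y => inner ℂ (hι.expOp j (-t) x) y =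
        inner ℂ x (hι.expOp j t y)) ?_ h1 x y
    exact isClosed_eq (by fun_prop) (by fun_prop)
  · rw [expOp, expOp, dif_neg ht, dif_neg (by rwa [abs_neg]), star_zero]

theorem IsAnalyticRep.expOp_expSeries (i j : Fin n) {s t : ℝ} (hs : 2 * ρ * |s| < 1)
    (ht : 2 * ρ * |t| < 1) (p : MvPolynomial (Fin n) ℂ) :
    hι.expOp i s (expSeries ι j t p) =
      ∑' l, ∑' k, (expCoeff s k * expCoeff t l) • ι (X i ^ k * X j ^ l * p) := by
  rw [expSeries, ContinuousLinearMap.map_tsum _ (hι.summable j ht p)]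
  congr with l
  rw [map_smul, hι.expOp_apply i hs, expSeries, ← tsum_const_smul'']
  congr with k
  rw [smul_smul, mul_comm, mul_assoc]

theorem IsAnalyticRep.expOp_comm (i j : Fin n) (s t : ℝ) :
    hι.expOp i s * hι.expOp j t = hι.expOp j t * hι.expOp i s := by
  by_cases hs : 2 * ρ * |s| < 1
  · by_cases ht : 2 * ρ * |t| < 1
    · refine ContinuousLinearMap.ext fun v => ?_
      refine congrFun (hι.dense.equalizer (by fun_prop) (by fun_prop) (funext fun p => ?_)) v
      have h1 := hι.expOp_expSeries i j hs ht p
      have h2 := hι.expOp_expSeries j i ht hs p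
      rw [← hι.expOp_apply j ht] at h1
      rw [← hι.expOp_apply i hs] at h2
      refine h1.trans (Eq.trans ?_ h2.symm)
      have h3 := Summable.tsum_comm (f := fun k l : ℕ =>
        (expCoeff s k * expCoeff t l) • ι (X i ^ k * X j ^ l * p)) (hι.summable_prod i j hs ht p)
      refine h3.trans (tsum_congr fun k => tsum_congr fun l => ?_)
      have e1 : X i ^ k * X j ^ l * p = X j ^ l * X i ^ k * p := by ring
      have e2 : expCoeff s k * expCoeff t l = expCoeff t l * expCoeff s k := mul_comm _ _
      simp only [e1, e2]
    · have : hι.expOp j t = 0 := by rw [expOp, dif_neg ht]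
      simp [this]
  · have : hι.expOp i s = 0 := by rw [expOp, dif_neg hs]
    simp [this]

/-- The difference quotient bound comparing a bounded operator `A` commuting with `exp (i τ X_j)`
with multiplication operators. -/
theorem IsAnalyticRep.norm_expOp_sub_le (j : Fin n) {t : ℝ} (h0 : 0 < t) (ht : 2 * ρ * |t| < 1)
    (A : H →L[ℂ] H) (hA : ∀ τ, A * hι.expOp j τ = hι.expOp j τ * A)
    (p q : MvPolynomial (Fin n) ℂ) :
    ‖hι.expOp j t (A (ι p) - ι q) - hι.expOp j (-t) (A (ι p) - ι q)‖ ≤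
      2 * t * ‖A (ι (X j * p)) - ι (X j * q)‖ := by
  have hρ := hι.pos
  have hmem : ∀ τ ∈ Set.Icc (-t) t, 2 * ρ * |τ| < 1 := fun τ hτ => by
    have : |τ| ≤ |t| := by rw [abs_of_pos h0]; exact abs_le.2 hτ
    refine lt_of_le_of_lt ?_ ht
    gcongr
  have hAv : ∀ τ v, hι.expOp j τ (A v) = A (hι.expOp j τ v) := fun τ v =>
    (DFunLike.congr_fun (hA τ) v).symm
  have hder : ∀ τ ∈ Set.Icc (-t) t, HasDerivWithinAt (fun τ => hι.expOp j τ (A (ι p) - ι q))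
      (Complex.I • hι.expOp j τ (A (ι (X j * p)) - ι (X j * q))) (Set.Icc (-t) t) τ := by
    intro τ hτ
    have h1 := (A.restrictScalars ℝ).hasFDerivAt.comp_hasDerivAt τ
      (hι.hasDerivAt_expSeries j (hmem τ hτ) p)
    have h2 := (h1.sub (hι.hasDerivAt_expSeries j (hmem τ hτ) q)).hasDerivWithinAt
      (s := Set.Icc (-t) t)
    have hval : ∀ σ ∈ Set.Icc (-t) t, ∀ p q, hι.expOp j σ (A (ι p) - ι q) =
        A (expSeries ι j σ p) - expSeries ι j σ q := fun σ hσ p q => by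
      rw [map_sub, hAv, hι.expOp_apply j (hmem σ hσ), hι.expOp_apply j (hmem σ hσ)]
    refine (h2.congr_of_mem (fun σ hσ => ?_) hτ).congr_deriv ?_
    · rw [hval σ hσ]; rfl
    · rw [hval τ hτ, smul_sub, ← map_smul]; rfl
  have := (convex_Icc (-t) t).norm_image_sub_le_of_norm_hasDerivWithin_le hder
    (C := ‖A (ι (X j * p)) - ι (X j * q)‖)
    (fun τ _ => by
      rw [norm_smul, Complex.norm_I, one_mul]; exact hι.norm_expOp_apply_le j τ _)
    (Set.left_mem_Icc.2 (by linarith)) (Set.right_mem_Icc.2 (by linarith))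
  refine this.trans (le_of_eq ?_)
  rw [Real.norm_eq_abs, abs_of_pos (by linarith)]
  ring

open Filter Topology in
theorem IsAnalyticRep.re_inner_nonneg (f : MvPolynomial (Fin n) ℝ) (hf : ∀ x, 0 ≤ eval x f) :
    0 ≤ (inner ℂ (ι 1) (ι (map Complex.ofRealHom f))).re := by
  have hρ := hι.pos
  let s : Set (H →L[ℂ] H) := {U | ∃ j t, U = hι.expOp j t}
  obtain ⟨B, _, φ, hφ⟩ := exists_commCStarAlgebra_hom s
    (by rintro _ ⟨i, s, rfl⟩ _ ⟨j, t, rfl⟩; exact hι.expOp_comm i j s t)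
    (by rintro _ ⟨i, s, rfl⟩ _ ⟨j, t, rfl⟩
        rw [hι.star_expOp]; exact hι.expOp_comm i j s (-t))
  have hφ' : ∀ j t, ∃ b, φ b = hι.expOp j t := fun j t => hφ _ ⟨j, t, rfl⟩
  choose b hb using hφ'
  let S : ℝ → Fin n → B := fun t j => (2 * Complex.I * t : ℂ)⁻¹ • (b j t - star (b j t))
  have hS : ∀ t j, IsSelfAdjoint (S t j) := fun t j => by
    rw [IsSelfAdjoint, star_smul, star_sub, star_star, ← neg_sub (b j t), smul_neg, ← neg_smul]
    simp [S]
  have hSφ : ∀ t j v, φ (S t j) v =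
      (2 * Complex.I * t : ℂ)⁻¹ • (hι.expOp j t v - hι.expOp j (-t) v) := fun t j v => by
    simp only [S, map_smul, map_sub, map_star, hb, hι.star_expOp]
    rfl
  have hcommφ : ∀ x y, φ x * φ y = φ y * φ x := fun x y => by
    rw [← map_mul, mul_comm, map_mul]
  have hsmall : ∀ᶠ t : ℝ in 𝓝[>] 0, 0 < t ∧ 2 * ρ * |t| < 1 := by
    refine (eventually_mem_nhdsWithin (a := (0 : ℝ)) (s := Set.Ioi 0)).and
      (nhdsWithin_le_nhds ?_)
    have : Continuous fun τ : ℝ => 2 * ρ * |τ| := by fun_prop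
    exact this.continuousAt.eventually_lt_const (by simp)
  have hX : ∀ j p, Tendsto (fun t => φ (S t j) (ι p)) (𝓝[>] 0) (𝓝 (ι (X j * p))) := by
    intro j p
    have h1 := hι.hasDerivAt_expSeries j (t := 0) (by simp) p
    have h2 := (h1.sub (h1.scomp_of_eq (0 : ℝ) (hasDerivAt_neg 0) (by simp)))
    have h3 := (hasDerivAt_iff_tendsto_slope_zero.1 h2).mono_left
      (nhdsWithin_mono _ (fun x (hx : 0 < x) => hx.ne'))
    have h4 := h3.const_smul (2 * Complex.I : ℂ)⁻¹
    have e : (2 * Complex.I : ℂ)⁻¹ • (Complex.I • expSeries ι j 0 (X j * p) -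
        (-1 : ℝ) • Complex.I • expSeries ι j 0 (X j * p)) = ι (X j * p) := by
      rw [expSeries_zero]
      have : (2 * Complex.I : ℂ) ≠ 0 := by simp
      rw [neg_smul, one_smul, sub_neg_eq_add, ← two_smul ℂ, smul_smul, smul_smul]
      rw [mul_assoc, inv_mul_cancel₀ this, one_smul]
    rw [e] at h4
    refine h4.congr' ?_
    filter_upwards [hsmall] with t ht
    rw [hSφ, hι.expOp_apply j ht.2, hι.expOp_apply j (by rw [abs_neg]; exact ht.2)]
    simp only [zero_add, Pi.sub_apply, Function.comp_apply, neg_zero, sub_self, sub_zero, mul_inv]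
    rw [mul_smul, mul_smul, mul_smul, ← Complex.ofReal_inv, Complex.coe_smul]
  have hconv : ∀ (f : MvPolynomial (Fin n) ℂ) p,
      Tendsto (fun t => φ (aeval (S t) f) (ι p)) (𝓝[>] 0) (𝓝 (ι (f * p))) := by
    intro f
    induction f using MvPolynomial.induction_on with
    | C a =>
      intro p
      have : ∀ t, φ (aeval (S t) (C a)) (ι p) = ι (C a * p) := fun t => by
        rw [aeval_C, AlgHomClass.commutes, C_mul', map_smul]; rfl
      simp only [this, tendsto_const_nhds]
    | add f g hf hg =>
      intro p
      simp only [map_add, add_mul]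
      exact (hf p).add (hg p)
    | mul_X f j ih =>
      intro p
      have h1 := tendsto_iff_norm_sub_tendsto_zero.1 (ih (X j * p))
      have h2 := tendsto_iff_norm_sub_tendsto_zero.1 (hX j (f * p))
      rw [tendsto_iff_norm_sub_tendsto_zero]
      refine squeeze_zero' (Eventually.of_forall fun _ => norm_nonneg _) ?_
        (by simpa using h1.add h2)
      filter_upwards [hsmall] with t ht
      have e1 : φ (aeval (S t) (f * X j)) (ι p) - ι (f * X j * p) =
          φ (S t j) (φ (aeval (S t) f) (ι p) - ι (f * p)) +
            (φ (S t j) (ι (f * p)) - ι (X j * (f * p))) := by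
        rw [map_sub, mul_comm f, map_mul, map_mul, aeval_X, mul_assoc,
          mul_apply_eq_comp]
        abel
      rw [e1]
      refine (norm_add_le _ _).trans (add_le_add_left ?_ _)
      have h3 := hι.norm_expOp_sub_le j ht.1 ht.2 (φ (aeval (S t) f))
        (fun τ => by rw [← hb]; exact hcommφ _ _) p (f * p)
      rw [hSφ, norm_smul, norm_inv, mul_left_comm]
      have e2 : ‖(2 * Complex.I * t : ℂ)‖ = 2 * t := by simp [abs_of_pos ht.1]
      rw [e2, inv_mul_le_iff₀ (by linarith [ht.1])]
      exact h3
  have hlim := (tendsto_const_nhds (x := ι 1)).inner (𝕜 := ℂ) (hconv (map Complex.ofRealHom f) 1)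
  rw [mul_one] at hlim
  refine ge_of_tendsto' ((Complex.continuous_re.tendsto _).comp hlim) fun t => ?_
  obtain ⟨c, hc⟩ := exists_star_mul_self_eq_aeval (S t) (hS t) f hf
  simp only [Function.comp_apply, hc, map_mul, map_star, mul_apply_eq_comp,
    ContinuousLinearMap.star_eq_adjoint, ContinuousLinearMap.adjoint_inner_right]
  exact inner_self_nonneg (𝕜 := ℂ)

end AnalyticRep

/-- Factorial-exponential growth of the moments of a linear functional on polynomials. -/
structure ExpBdd {n : ℕ} (L : MvPolynomial (Fin n) ℝ →ₗ[ℝ] ℝ) (ρ : ℝ) : Prop where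
  pos : 0 < ρ
  bound : ∃ C, ∀ α : Fin n →₀ ℕ, |L (monomial α 1)| ≤ C * (ρ ^ α.degree * α.degree.factorial)

theorem factorial_add_le_two_pow (a b : ℕ) :
    (a + b).factorial ≤ 2 ^ (a + b) * (a.factorial * b.factorial) := by
  rw [← Nat.add_choose_mul_factorial_mul_factorial a b, mul_assoc]
  exact Nat.mul_le_mul_right _ (Nat.choose_le_two_pow _ _)

theorem exists_dense_linearMap_inner {E : Type u} [AddCommGroup E] [Module ℂ E]
    (c : PreInnerProductSpace.Core ℂ E) :
    ∃ (H : Type u) (_ : NormedAddCommGroup H) (_ : InnerProductSpace ℂ H) (_ : CompleteSpace H)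
      (ι : E →ₗ[ℂ] H), DenseRange ι ∧ ∀ x y, inner ℂ (ι x) (ι y) = c.inner x y := by
  let _ : SeminormedAddCommGroup E := InnerProductSpace.Core.toSeminormedAddCommGroup (c := c)
  let _ : InnerProductSpace ℂ E := InnerProductSpace.ofCore c
  exact ⟨UniformSpace.Completion E, inferInstance, inferInstance, inferInstance,
    (UniformSpace.Completion.toComplₗᵢ (𝕜 := ℂ)).toLinearMap,
    UniformSpace.Completion.denseRange_coe, UniformSpace.Completion.inner_coe⟩

section ExpBdd

variable {n : ℕ} {L : MvPolynomial (Fin n) ℝ →ₗ[ℝ] ℝ} {ρ : ℝ}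

theorem ExpBdd.exists_bound (hL : ExpBdd L ρ) (r : MvPolynomial (Fin n) ℝ) :
    ∃ C, 0 ≤ C ∧ ∀ α : Fin n →₀ ℕ,
      |L (r * monomial α 1)| ≤ C * ((2 * ρ) ^ α.degree * α.degree.factorial) := by
  have hρ := hL.pos
  induction r using MvPolynomial.induction_on' with
  | monomial β c =>
    obtain ⟨C, hC⟩ := hL.bound
    have hC0 : 0 ≤ C := by simpa using (abs_nonneg _).trans (hC 0)
    refine ⟨|c| * (C * (2 * ρ) ^ β.degree * β.degree.factorial), by positivity, fun α => ?_⟩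
    have e : (monomial β c * monomial α 1 : MvPolynomial (Fin n) ℝ) =
        c • monomial (β + α) 1 := by
      rw [monomial_mul, smul_monomial]; simp
    rw [e, map_smul, smul_eq_mul, abs_mul]
    have h := hC (β + α)
    have hf : ((β + α).degree.factorial : ℝ) ≤
        2 ^ (β.degree + α.degree) * (β.degree.factorial * α.degree.factorial) := by
      rw [map_add]
      exact_mod_cast factorial_add_le_two_pow β.degree α.degree
    calc |c| * |L (monomial (β + α) 1)|
        ≤ |c| * (C * (ρ ^ (β + α).degree *
          (2 ^ (β.degree + α.degree) * (β.degree.factorial * α.degree.factorial)))) := by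
            refine mul_le_mul_of_nonneg_left (h.trans ?_) (abs_nonneg _)
            gcongr
      _ = _ := by rw [map_add, pow_add, pow_add, mul_pow, mul_pow]; ring
  | add p q hp hq =>
    obtain ⟨A, hA0, hA⟩ := hp
    obtain ⟨B, hB0, hB⟩ := hq
    refine ⟨A + B, by positivity, fun α => ?_⟩
    rw [add_mul, map_add, add_mul]
    exact (abs_add_le _ _).trans (add_le_add (hA α) (hB α))

/-- The functional `p ↦ L (r * p)`. -/
noncomputable def mulFunctional (L : MvPolynomial (Fin n) ℝ →ₗ[ℝ] ℝ)
    (r : MvPolynomial (Fin n) ℝ) : MvPolynomial (Fin n) ℝ →ₗ[ℝ] ℝ :=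
  L ∘ₗ LinearMap.mulLeft ℝ r

@[simp]
theorem mulFunctional_apply (r p : MvPolynomial (Fin n) ℝ) :
    mulFunctional L r p = L (r * p) := rfl

theorem ExpBdd.mulFunctional (hL : ExpBdd L ρ) (r : MvPolynomial (Fin n) ℝ) :
    ExpBdd (mulFunctional L r) (2 * ρ) :=
  ⟨by have := hL.pos; positivity, by
    obtain ⟨C, -, hC⟩ := hL.exists_bound r
    exact ⟨C, hC⟩⟩

/-- The complex-linear extension of a real functional on polynomials. -/
noncomputable def complexify (L : MvPolynomial (Fin n) ℝ →ₗ[ℝ] ℝ) :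
    MvPolynomial (Fin n) ℂ →ₗ[ℂ] ℂ :=
  (basisMonomials (Fin n) ℂ).constr ℂ fun α => (L (monomial α 1) : ℂ)

theorem complexify_monomial (α : Fin n →₀ ℕ) (c : ℂ) :
    complexify L (monomial α c) = c * L (monomial α 1) := by
  have h := (basisMonomials (Fin n) ℂ).constr_basis ℂ (fun α => (L (monomial α 1) : ℂ)) α
  rw [coe_basisMonomials] at h
  have e : (monomial α c : MvPolynomial (Fin n) ℂ) = c • monomial α 1 := by
    rw [smul_monomial]; simp
  rw [e, map_smul, complexify, h, smul_eq_mul]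

theorem complexify_map_ofReal (p : MvPolynomial (Fin n) ℝ) :
    complexify L (map Complex.ofRealHom p) = L p := by
  induction p using MvPolynomial.induction_on' with
  | monomial β c =>
    have e : (monomial β c : MvPolynomial (Fin n) ℝ) = c • monomial β 1 := by
      rw [smul_monomial]; simp
    rw [map_monomial, complexify_monomial, e, map_smul]
    simp
  | add p q hp hq => simp [hp, hq]

theorem complexify_map_conj (p : MvPolynomial (Fin n) ℂ) :
    complexify L (map (starRingEnd ℂ) p) = starRingEnd ℂ (complexify L p) := by
  induction p using MvPolynomial.induction_on' with
  | monomial β c => simp [complexify_monomial]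
  | add p q hp hq => simp [hp, hq]

theorem map_conj_map_conj (p : MvPolynomial (Fin n) ℂ) :
    map (starRingEnd ℂ) (map (starRingEnd ℂ) p) = p := by
  rw [map_map]
  convert map_id p
  ext
  simp

theorem exists_map_conj_mul_self (p : MvPolynomial (Fin n) ℂ) :
    ∃ a b : MvPolynomial (Fin n) ℝ,
      map (starRingEnd ℂ) p * p = map Complex.ofRealHom (a ^ 2 + b ^ 2) := by
  have hconj : (starRingEnd ℂ).comp Complex.ofRealHom = Complex.ofRealHom := by ext; simp
  have h : ∃ a b : MvPolynomial (Fin n) ℝ,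
      p = map Complex.ofRealHom a + C Complex.I * map Complex.ofRealHom b := by
    induction p using MvPolynomial.induction_on with
    | C c =>
      refine ⟨C c.re, C c.im, ?_⟩
      rw [map_C, map_C, ← C_mul, ← C_add]
      congr 1
      simp [mul_comm Complex.I, Complex.re_add_im]
    | add p q hp hq =>
      obtain ⟨a, b, h⟩ := hp
      obtain ⟨a', b', h'⟩ := hq
      refine ⟨a + a', b + b', ?_⟩
      rw [h, h', map_add, map_add]
      ring
    | mul_X p j hp =>
      obtain ⟨a, b, h⟩ := hp
      refine ⟨a * X j, b * X j, ?_⟩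
      rw [h, map_mul, map_mul, map_X]
      ring
  obtain ⟨a, b, rfl⟩ := h
  refine ⟨a, b, ?_⟩
  have hI : (C Complex.I * C Complex.I : MvPolynomial (Fin n) ℂ) = -1 := by
    rw [← C_mul, Complex.I_mul_I]; simp
  rw [map_add, map_mul, map_map, map_map, hconj, map_C, Complex.conj_I, C_neg, map_add, map_pow,
    map_pow]
  linear_combination (- (map Complex.ofRealHom b) ^ 2) * hI

/-- The semi-inner product on complex polynomials induced by a functional which is nonnegative on
squares. -/
noncomputable abbrev gnsCore (hL : ∀ p, 0 ≤ L (p ^ 2)) :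
    PreInnerProductSpace.Core ℂ (MvPolynomial (Fin n) ℂ) where
  inner p q := complexify L (map (starRingEnd ℂ) p * q)
  conj_inner_symm p q := by
    rw [← complexify_map_conj, map_mul, map_conj_map_conj, mul_comm]
  re_inner_nonneg p := by
    obtain ⟨a, b, h⟩ := exists_map_conj_mul_self p
    rw [h, complexify_map_ofReal, map_add]
    exact add_nonneg (hL a) (hL b)
  add_left p q r := by rw [map_add, add_mul, map_add]
  smul_left p q c := by
    rw [smul_eq_C_mul, map_mul (map _), map_C, mul_assoc, ← smul_eq_C_mul, map_smul, smul_eq_mul]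

/-- A functional on polynomials nonnegative on squares, whose moments grow at most like
factorials, is nonnegative on globally nonnegative polynomials. -/
theorem ExpBdd.nonneg_of_eval_nonneg (hb : ExpBdd L ρ) (hL : ∀ p, 0 ≤ L (p ^ 2))
    (f : MvPolynomial (Fin n) ℝ) (hf : ∀ x, 0 ≤ eval x f) : 0 ≤ L f := by
  have hρ := hb.pos
  obtain ⟨H, _, _, _, ι, hdense, hinner⟩ := exists_dense_linearMap_inner (gnsCore hL)
  have hinner : ∀ p q, inner ℂ (ι p) (ι q) = complexify L (map (starRingEnd ℂ) p * q) := hinner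
  have hι : IsAnalyticRep ι (4 * ρ) := by
    refine ⟨by positivity, hdense, fun j p q => ?_, fun p => ?_⟩
    · rw [hinner, hinner, map_mul (map _), map_X]
      congr 1
      ring
    · obtain ⟨a, b, hab⟩ := exists_map_conj_mul_self p
      obtain ⟨C, hC0, hC⟩ := hb.exists_bound (a ^ 2 + b ^ 2)
      refine ⟨√C, fun i j k l => ?_⟩
      have h1 : ‖ι (X i ^ k * X j ^ l * p)‖ ^ 2 =
          L ((a ^ 2 + b ^ 2) * monomial (Finsupp.single i (2 * k) + Finsupp.single j (2 * l)) 1) := by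
        rw [← Complex.ofReal_inj, ← complexify_map_ofReal, map_mul (map _), ← hab]
        have := inner_self_eq_norm_sq_to_K (𝕜 := ℂ) (ι (X i ^ k * X j ^ l * p))
        rw [Complex.ofReal_pow]
        refine this.symm.trans ?_
        rw [hinner]
        congr 1
        have e : (monomial (Finsupp.single i (2 * k) + Finsupp.single j (2 * l)) 1 :
            MvPolynomial (Fin n) ℝ) = X i ^ (2 * k) * X j ^ (2 * l) := by
          rw [X_pow_eq_monomial, X_pow_eq_monomial, monomial_mul, one_mul]
        rw [e]
        simp only [map_mul, map_pow, map_X]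
        ring
      have h2 := (le_abs_self _).trans
        (hC (Finsupp.single i (2 * k) + Finsupp.single j (2 * l)))
      rw [← h1, map_add, Finsupp.degree_single, Finsupp.degree_single, ← mul_add] at h2
      have h3 : ((2 * (k + l)).factorial : ℝ) ≤
          2 ^ (2 * (k + l)) * ((k + l).factorial * (k + l).factorial) := by
        rw [two_mul]
        exact_mod_cast factorial_add_le_two_pow (k + l) (k + l)
      refine abs_le_of_sq_le_sq' (h2.trans ?_) (by positivity) |>.2
      calc C * ((2 * ρ) ^ (2 * (k + l)) * ((2 * (k + l)).factorial : ℝ))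
          ≤ C * ((2 * ρ) ^ (2 * (k + l)) *
            (2 ^ (2 * (k + l)) * ((k + l).factorial * (k + l).factorial))) := by gcongr
        _ = (√C) ^ 2 * ((2 * ρ) ^ (2 * (k + l)) *
            (2 ^ (2 * (k + l)) * ((k + l).factorial * (k + l).factorial))) := by
              rw [Real.sq_sqrt hC0]
        _ = _ := by
              rw [show 4 * ρ = (2 * ρ) * 2 by ring, mul_pow (2 * ρ) 2, pow_mul', pow_mul']; ring
  have h := hι.re_inner_nonneg f hf
  rw [hinner, map_one, one_mul, complexify_map_ofReal] at h
  exact h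

end ExpBdd

section Haviland

variable {n : ℕ}

/-- The functions on `ℝⁿ` bounded by a polynomial. -/
def polyGrowth (n : ℕ) : Submodule ℝ ((Fin n → ℝ) → ℝ) where
  carrier := {h | ∃ q : MvPolynomial (Fin n) ℝ, ∀ x, |h x| ≤ eval x q}
  add_mem' := by
    rintro h k ⟨q, hq⟩ ⟨r, hr⟩
    exact ⟨q + r, fun x => by
      rw [map_add]; exact (abs_add_le _ _).trans (add_le_add (hq x) (hr x))⟩
  zero_mem' := ⟨0, by simp⟩
  smul_mem' := by
    rintro c h ⟨q, hq⟩
    exact ⟨C |c| * q, fun x => by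
      rw [map_mul, eval_C, Pi.smul_apply, smul_eq_mul, abs_mul]
      exact mul_le_mul_of_nonneg_left (hq x) (abs_nonneg _)⟩

theorem abs_eval_le (q : MvPolynomial (Fin n) ℝ) (x : Fin n → ℝ) :
    |eval x q| ≤ eval x (q ^ 2 + 1) := by
  rw [map_add, map_pow, map_one, ← sq_abs]
  nlinarith [sq_nonneg (|eval x q| - 1), abs_nonneg (eval x q)]

/-- The polynomial functions, as functions of polynomial growth. -/
noncomputable def evalPolyGrowth (n : ℕ) : MvPolynomial (Fin n) ℝ →ₗ[ℝ] polyGrowth n where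
  toFun q := ⟨fun x => eval x q, q ^ 2 + 1, abs_eval_le q⟩
  map_add' _ _ := Subtype.ext (funext fun _ => map_add _ _ _)
  map_smul' _ _ := Subtype.ext (funext fun _ => smul_eval _ _ _)

theorem evalPolyGrowth_injective : Function.Injective (evalPolyGrowth n) := fun _ _ h =>
  MvPolynomial.funext fun x => congrFun (congrArg Subtype.val h) x

theorem exists_positive_extension (L : MvPolynomial (Fin n) ℝ →ₗ[ℝ] ℝ)
    (hL : ∀ f, (∀ x, 0 ≤ eval x f) → 0 ≤ L f) :
    ∃ G : polyGrowth n →ₗ[ℝ] ℝ, (∀ q, G (evalPolyGrowth n q) = L q) ∧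
      ∀ h : polyGrowth n, (∀ x, 0 ≤ (h : (Fin n → ℝ) → ℝ) x) → 0 ≤ G h := by
  let s : PointedCone ℝ (polyGrowth n) :=
    { carrier := {h | ∀ x, 0 ≤ (h : (Fin n → ℝ) → ℝ) x}
      add_mem' := fun ha hb x => add_nonneg (ha x) (hb x)
      zero_mem' := fun x => le_rfl
      smul_mem' := fun c h hh x => mul_nonneg c.2 (hh x) }
  let e := LinearEquiv.ofInjective (evalPolyGrowth n) evalPolyGrowth_injective
  let F : polyGrowth n →ₗ.[ℝ] ℝ :=
    { domain := LinearMap.range (evalPolyGrowth n)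
      toFun := L ∘ₗ e.symm.toLinearMap }
  have hF : ∀ q (h : evalPolyGrowth n q ∈ F.domain), F ⟨evalPolyGrowth n q, h⟩ = L q :=
    fun q h => by
      change L (e.symm _) = L q
      congr 1
      rw [LinearEquiv.symm_apply_eq]
      rfl
  obtain ⟨G, hG, hG'⟩ := riesz_extension s F
    (by
      rintro ⟨_, q, rfl⟩ hq
      exact (hL q hq).trans_eq (hF q _).symm)
    (by
      rintro ⟨h, q, hq⟩
      refine ⟨⟨_, q, rfl⟩, fun x => ?_⟩
      have := (abs_le.1 (hq x)).1
      change 0 ≤ eval x q + h x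
      linarith)
  exact ⟨G, fun q => (hG ⟨_, q, rfl⟩).trans (hF q _), hG'⟩

/-- The squared Euclidean norm as a polynomial. -/
noncomputable def sumSq (n : ℕ) : MvPolynomial (Fin n) ℝ := ∑ i, X i ^ 2

theorem eval_sumSq (x : Fin n → ℝ) : eval x (sumSq n) = ∑ i, x i ^ 2 := by
  simp [sumSq]

theorem eval_sumSq_nonneg (x : Fin n → ℝ) : 0 ≤ eval x (sumSq n) := by
  rw [eval_sumSq]; positivity

theorem isCompact_sumSq_le (R : ℝ) : IsCompact {x : Fin n → ℝ | eval x (sumSq n) ≤ R} := by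
  refine Metric.isCompact_of_isClosed_isBounded
    (isClosed_le (MvPolynomial.continuous_eval _) continuous_const) ?_
  refine (Metric.isBounded_closedBall (x := (0 : Fin n → ℝ)) (r := √R)).subset fun x hx => ?_
  rw [mem_closedBall_zero_iff, pi_norm_le_iff_of_nonneg (Real.sqrt_nonneg _)]
  intro i
  refine Real.abs_le_sqrt (le_trans ?_ hx)
  rw [eval_sumSq]
  exact Finset.single_le_sum (f := fun i => x i ^ 2) (fun i _ => sq_nonneg _) (Finset.mem_univ i)

/-- A continuous compactly supported cutoff function, equal to one where `|x|² ≤ k`. -/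
noncomputable def cutoff (k : ℕ) (x : Fin n → ℝ) : ℝ :=
  max 0 (min 1 (k + 1 - eval x (sumSq n)))

theorem cutoff_nonneg (k : ℕ) (x : Fin n → ℝ) : 0 ≤ cutoff k x := le_max_left _ _

theorem cutoff_le_one (k : ℕ) (x : Fin n → ℝ) : cutoff k x ≤ 1 :=
  max_le zero_le_one (min_le_left _ _)

theorem cutoff_eq_one {k : ℕ} {x : Fin n → ℝ} (h : eval x (sumSq n) ≤ k) : cutoff k x = 1 := by
  rw [cutoff, min_eq_left (by linarith), max_eq_right zero_le_one]

theorem continuous_cutoff (k : ℕ) : Continuous (cutoff k : (Fin n → ℝ) → ℝ) :=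
  continuous_const.max (continuous_const.min
    (continuous_const.sub (MvPolynomial.continuous_eval _)))

theorem hasCompactSupport_cutoff (k : ℕ) : HasCompactSupport (cutoff k : (Fin n → ℝ) → ℝ) := by
  refine HasCompactSupport.intro (isCompact_sumSq_le (k + 1)) fun x hx => ?_
  rw [Set.mem_ofPred_eq, not_le] at hx
  rw [cutoff, max_eq_left (min_le_of_right_le (by linarith))]

theorem one_sub_cutoff_le {k : ℕ} (hk : 0 < k) (x : Fin n → ℝ) :
    1 - cutoff k x ≤ eval x (sumSq n) / k := by
  have hk' : (0 : ℝ) < k := by exact_mod_cast hk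
  by_cases h : eval x (sumSq n) ≤ k
  · rw [cutoff_eq_one h, sub_self]
    exact div_nonneg (eval_sumSq_nonneg x) hk'.le
  · rw [not_le] at h
    have : 1 ≤ eval x (sumSq n) / k := (one_le_div hk').2 h.le
    linarith [cutoff_nonneg k x]

/-- The product of a polynomial with the cutoff function. -/
noncomputable def cutoffMul (q : MvPolynomial (Fin n) ℝ) (k : ℕ) :
    CompactlySupportedContinuousMap (Fin n → ℝ) ℝ where
  toFun x := eval x q * cutoff k x
  continuous_toFun := (MvPolynomial.continuous_eval q).mul (continuous_cutoff k)
  hasCompactSupport' := (hasCompactSupport_cutoff k).mul_left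

theorem continuous_cutoffMul (q : MvPolynomial (Fin n) ℝ) (k : ℕ) :
    Continuous fun x => cutoffMul q k x :=
  (cutoffMul q k).continuous

open MeasureTheory Filter Topology

/-- **Haviland's theorem** on `ℝⁿ`: a functional on polynomials that is nonnegative on the
nonnegative polynomials is integration against a measure. -/
theorem exists_measure_of_nonneg (L : MvPolynomial (Fin n) ℝ →ₗ[ℝ] ℝ)
    (hL : ∀ f, (∀ x, 0 ≤ eval x f) → 0 ≤ L f) :
    ∃ μ : Measure (Fin n → ℝ), IsFiniteMeasure μ ∧
      ∀ q, Integrable (fun x => eval x q) μ ∧ ∫ x, eval x q ∂μ = L q := by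
  obtain ⟨G, hGL, hG⟩ := exists_positive_extension L hL
  have hmem : ∀ h : CompactlySupportedContinuousMap (Fin n → ℝ) ℝ, ⇑h ∈ polyGrowth n := fun h => by
    obtain ⟨c, hc⟩ := h.continuous.bounded_above_of_compact_support h.hasCompactSupport
    exact ⟨C c, fun x => by rw [eval_C]; exact hc x⟩
  let Λ : CompactlySupportedContinuousMap (Fin n → ℝ) ℝ →ₚ[ℝ] ℝ :=
    PositiveLinearMap.mk₀
      { toFun := fun h => G ⟨h, hmem h⟩
        map_add' := fun h k => by rw [← map_add]; rfl
        map_smul' := fun c h => by rw [RingHom.id_apply, ← map_smul]; rfl }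
      (fun h hh => hG _ hh)
  let μ := RealRMK.rieszMeasure Λ
  have hμ : ∀ h : CompactlySupportedContinuousMap (Fin n → ℝ) ℝ,
      ∫ x, h x ∂μ = G ⟨h, hmem h⟩ := RealRMK.integral_rieszMeasure Λ
  have hlim : ∀ x : Fin n → ℝ, Tendsto (fun k => cutoff k x) atTop (𝓝 1) := fun x => by
    refine tendsto_const_nhds.congr' ?_
    obtain ⟨N, hN⟩ := exists_nat_ge (eval x (sumSq n))
    filter_upwards [eventually_ge_atTop N] with k hk
    exact (cutoff_eq_one (hN.trans (by exact_mod_cast hk))).symm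
  have hle : ∀ q : MvPolynomial (Fin n) ℝ, (∀ x, 0 ≤ eval x q) →
      ∫⁻ x, ENNReal.ofReal (eval x q) ∂μ ≤ ENNReal.ofReal (L q) := fun q hq => by
    have h1 : ∀ x, ENNReal.ofReal (eval x q) =
        liminf (fun k => ENNReal.ofReal (cutoffMul q k x)) atTop := fun x => by
      refine (Tendsto.liminf_eq ?_).symm
      refine ENNReal.tendsto_ofReal ?_
      have h := (hlim x).const_mul (eval x q)
      rwa [mul_one] at h
    simp_rw [h1]
    refine (lintegral_liminf_le fun k =>
      (continuous_cutoffMul q k).measurable.ennreal_ofReal).trans ?_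
    refine liminf_le_of_le (by isBoundedDefault) fun b hb => ?_
    obtain ⟨k, hk⟩ := hb.exists
    refine hk.trans ?_
    rw [← ofReal_integral_eq_lintegral_ofReal
      ((continuous_cutoffMul q k).integrable_of_hasCompactSupport (cutoffMul q k).hasCompactSupport)
      (Eventually.of_forall fun x => mul_nonneg (hq x) (cutoff_nonneg k x)), hμ]
    refine ENNReal.ofReal_le_ofReal ?_
    rw [← sub_nonneg, ← hGL, ← map_sub]
    refine hG _ fun x => ?_
    change 0 ≤ eval x q - eval x q * cutoff k x
    nlinarith [hq x, cutoff_le_one k x]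
  have hfin : IsFiniteMeasure μ := ⟨by
    have := hle 1 (by simp)
    simp only [map_one, ENNReal.ofReal_one, lintegral_const, one_mul] at this
    exact this.trans_lt ENNReal.ofReal_lt_top⟩
  have hint : ∀ q : MvPolynomial (Fin n) ℝ, Integrable (fun x => eval x q) μ := fun q => by
    have hq0 : ∀ x, 0 ≤ eval x (q ^ 2 + 1) := fun x => (abs_nonneg _).trans (abs_eval_le q x)
    have h1 : Integrable (fun x => eval x (q ^ 2 + 1)) μ := by
      refine ⟨(MvPolynomial.continuous_eval _).aestronglyMeasurable, ?_⟩
      rw [hasFiniteIntegral_iff_ofReal (Eventually.of_forall hq0)]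
      exact (hle _ hq0).trans_lt ENNReal.ofReal_lt_top
    exact h1.mono' (MvPolynomial.continuous_eval _).aestronglyMeasurable
      (Eventually.of_forall fun x => abs_eval_le q x)
  refine ⟨μ, hfin, fun q => ⟨hint q, ?_⟩⟩
  have hT1 : Tendsto (fun k => ∫ x, cutoffMul q k x ∂μ) atTop (𝓝 (∫ x, eval x q ∂μ)) := by
    refine tendsto_integral_of_dominated_convergence (fun x => |eval x q|)
      (fun k => (continuous_cutoffMul q k).aestronglyMeasurable) (hint q).abs
      (fun k => Eventually.of_forall fun x => ?_) (Eventually.of_forall fun x => ?_)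
    · change |eval x q * cutoff k x| ≤ _
      rw [abs_mul, abs_of_nonneg (cutoff_nonneg k x)]
      exact mul_le_of_le_one_right (abs_nonneg _) (cutoff_le_one k x)
    · have h := (hlim x).const_mul (eval x q)
      rwa [mul_one] at h
  have hbd : ∀ k : ℕ, 0 < k → |∫ x, cutoffMul q k x ∂μ - L q| ≤
      L ((q ^ 2 + 1) * sumSq n) * (k : ℝ)⁻¹ := fun k hk => by
    have hx : ∀ x, |eval x q * cutoff k x - eval x q| ≤
        eval x ((q ^ 2 + 1) * sumSq n) * (k : ℝ)⁻¹ := fun x => by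
      have e : eval x q * cutoff k x - eval x q = -(eval x q * (1 - cutoff k x)) := by ring
      rw [e, abs_neg, abs_mul, abs_of_nonneg (sub_nonneg.2 (cutoff_le_one k x)), map_mul,
        mul_assoc, ← div_eq_mul_inv]
      exact mul_le_mul (abs_eval_le q x) (one_sub_cutoff_le hk x)
        (sub_nonneg.2 (cutoff_le_one k x)) ((abs_nonneg _).trans (abs_eval_le q x))
    rw [hμ, ← hGL q, ← map_sub, abs_le, mul_comm, ← smul_eq_mul, ← map_smul, ← hGL]
    constructor
    · rw [neg_le_iff_add_nonneg, ← map_add]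
      refine hG _ fun x => ?_
      have := (abs_le.1 (hx x)).1
      change 0 ≤ (eval x q * cutoff k x - eval x q) + eval x (_ • _)
      rw [smul_eval]
      linarith
    · rw [← sub_nonneg, ← map_sub]
      refine hG _ fun x => ?_
      have := (abs_le.1 (hx x)).2
      change 0 ≤ eval x (_ • _) - (eval x q * cutoff k x - eval x q)
      rw [smul_eval]
      linarith
  have hT2 : Tendsto (fun k => ∫ x, cutoffMul q k x ∂μ) atTop (𝓝 (L q)) := by
    rw [tendsto_iff_norm_sub_tendsto_zero]
    refine squeeze_zero' (Eventually.of_forall fun _ => norm_nonneg _)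
      ((eventually_gt_atTop 0).mono hbd) ?_
    simpa using tendsto_inv_atTop_nhds_zero_nat.const_mul (L ((q ^ 2 + 1) * sumSq n))
  exact tendsto_nhds_unique hT1 hT2

end Haviland

section Determinacy

open MeasureTheory ProbabilityTheory Filter Topology

theorem mem_integrableExpSet_of_moment_le {Ω : Type*} [MeasurableSpace Ω] {μ : Measure Ω}
    {Y : Ω → ℝ} (hY : Measurable Y) (hint : ∀ k, Integrable (fun ω => Y ω ^ k) μ) {C R : ℝ}
    (h : ∀ k, ∫ ω, Y ω ^ k ∂μ ≤ C * (R ^ k * k.factorial)) (hR : 0 ≤ R) {t : ℝ}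
    (ht : |t| * R < 1) : t ∈ integrableExpSet Y μ := by
  have hC : 0 ≤ C := by
    refine le_trans ?_ (by simpa using h 0)
    simp [measureReal_nonneg]
  have hcosh : Integrable (fun ω => Real.cosh (t * Y ω)) μ := by
    refine ⟨(Real.continuous_cosh.measurable.comp (hY.const_mul t)).aestronglyMeasurable, ?_⟩
    rw [hasFiniteIntegral_iff_ofReal (.of_forall fun ω => (Real.cosh_pos _).le)]
    have hpos : ∀ (ω : Ω) (k : ℕ), 0 ≤ (t * Y ω) ^ (2 * k) / (2 * k).factorial := fun ω k =>
      div_nonneg (by rw [pow_mul]; positivity) (by positivity)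
    have hterm : ∀ k : ℕ, ∫⁻ ω, ENNReal.ofReal ((t * Y ω) ^ (2 * k) / (2 * k).factorial) ∂μ ≤
        ENNReal.ofReal (C * ((|t| * R) ^ 2) ^ k) := fun k => by
      rw [← ofReal_integral_eq_lintegral_ofReal _ (.of_forall fun ω => hpos ω k)]
      · refine ENNReal.ofReal_le_ofReal ?_
        have e : (fun ω => (t * Y ω) ^ (2 * k) / ((2 * k).factorial : ℝ)) =
            fun ω => (t ^ (2 * k) / (2 * k).factorial) * Y ω ^ (2 * k) := by
          funext ω; rw [mul_pow]; ring
        have ht0 : 0 ≤ t ^ (2 * k) := by rw [pow_mul]; positivity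
        rw [e, integral_const_mul]
        calc t ^ (2 * k) / (2 * k).factorial * ∫ ω, Y ω ^ (2 * k) ∂μ
            ≤ t ^ (2 * k) / (2 * k).factorial * (C * (R ^ (2 * k) * (2 * k).factorial)) := by
              gcongr; exact h _
          _ = C * ((|t| * R) ^ 2) ^ k := by
              have : ((2 * k).factorial : ℝ) ≠ 0 := by positivity
              rw [mul_pow, sq_abs, mul_pow, ← pow_mul, ← pow_mul]
              field_simp
      · have e : (fun ω => (t * Y ω) ^ (2 * k) / ((2 * k).factorial : ℝ)) =
            fun ω => (t ^ (2 * k) / (2 * k).factorial) * Y ω ^ (2 * k) := by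
          funext ω; rw [mul_pow]; ring
        rw [e]
        exact (hint _).const_mul _
    have hsum : Summable fun k : ℕ => C * ((|t| * R) ^ 2) ^ k :=
      (summable_geometric_of_lt_one (by positivity)
        (pow_lt_one₀ (by positivity) ht two_ne_zero)).mul_left C
    calc ∫⁻ ω, ENNReal.ofReal (Real.cosh (t * Y ω)) ∂μ
        = ∫⁻ ω, ∑' k : ℕ, ENNReal.ofReal ((t * Y ω) ^ (2 * k) / (2 * k).factorial) ∂μ := by
          refine lintegral_congr fun ω => ?_
          rw [Real.cosh_eq_tsum, ENNReal.ofReal_tsum_of_nonneg (hpos ω)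
            (Real.hasSum_cosh _).summable]
      _ = ∑' k : ℕ, ∫⁻ ω, ENNReal.ofReal ((t * Y ω) ^ (2 * k) / (2 * k).factorial) ∂μ :=
          lintegral_tsum fun k => by fun_prop
      _ ≤ ∑' k : ℕ, ENNReal.ofReal (C * ((|t| * R) ^ 2) ^ k) := ENNReal.tsum_le_tsum hterm
      _ = ENNReal.ofReal (∑' k : ℕ, C * ((|t| * R) ^ 2) ^ k) :=
          (ENNReal.ofReal_tsum_of_nonneg (fun k => by positivity) hsum).symm
      _ < ⊤ := ENNReal.ofReal_lt_top
  refine (hcosh.const_mul 2).mono' (by fun_prop) (.of_forall fun ω => ?_)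
  rw [Real.norm_of_nonneg (Real.exp_pos _).le, Real.cosh_eq]
  linarith [Real.exp_pos (-(t * Y ω))]

theorem complexMGF_eq_of_moment_eq {Ω : Type*} [MeasurableSpace Ω] {μ ν : Measure Ω}
    {Y : Ω → ℝ} (hY : Measurable Y) (hμ : ∀ k, Integrable (fun ω => Y ω ^ k) μ)
    (hν : ∀ k, Integrable (fun ω => Y ω ^ k) ν)
    (hμν : ∀ k, ∫ ω, Y ω ^ k ∂μ = ∫ ω, Y ω ^ k ∂ν) {C R : ℝ} (hR : 0 < R)
    (h : ∀ k, ∫ ω, Y ω ^ k ∂μ ≤ C * (R ^ k * k.factorial)) {z : ℂ} (hz : z.re = 0) :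
    complexMGF Y μ z = complexMGF Y ν z := by
  have hsub : ∀ m : Measure Ω, (∀ k, Integrable (fun ω => Y ω ^ k) m) →
      (∀ k, ∫ ω, Y ω ^ k ∂m ≤ C * (R ^ k * k.factorial)) →
      Set.Ioo (-R⁻¹) R⁻¹ ⊆ interior (integrableExpSet Y m) := fun m hm hb =>
    interior_maximal (fun t ht => mem_integrableExpSet_of_moment_le hY hm hb hR.le (by
      have : |t| < R⁻¹ := abs_lt.2 ht
      calc |t| * R < R⁻¹ * R := by gcongr
        _ = 1 := inv_mul_cancel₀ hR.ne')) isOpen_Ioo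
  have hsμ := hsub μ hμ h
  have hsν := hsub ν hν fun k => hμν k ▸ h k
  set U : Set ℂ := {z | z.re ∈ Set.Ioo (-R⁻¹) R⁻¹}
  have hU : IsPreconnected U :=
    ((convex_Ioo (-R⁻¹) R⁻¹).linear_preimage Complex.reLm).isPreconnected
  have h0 : (0 : ℝ) ∈ Set.Ioo (-R⁻¹) R⁻¹ := by simp [hR]
  have hmem : ∀ w : ℂ, w.re = 0 → w ∈ U := fun w hw => by
    change w.re ∈ Set.Ioo (-R⁻¹) R⁻¹
    rwa [hw]
  have aμ : AnalyticOnNhd ℂ (complexMGF Y μ) U :=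
    analyticOnNhd_complexMGF.mono fun w hw => hsμ hw
  have aν : AnalyticOnNhd ℂ (complexMGF Y ν) U :=
    analyticOnNhd_complexMGF.mono fun w hw => hsν hw
  have h0U : (0 : ℂ) ∈ U := hmem 0 rfl
  have hder : ∀ k, iteratedDeriv k (complexMGF Y μ) 0 = iteratedDeriv k (complexMGF Y ν) 0 := by
    intro k
    rw [iteratedDeriv_complexMGF (hsμ h0U), iteratedDeriv_complexMGF (hsν h0U)]
    simp only [zero_mul, Complex.exp_zero, mul_one, ← Complex.ofReal_pow]
    rw [integral_complex_ofReal, integral_complex_ofReal, hμν]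
  have pμ := (aμ 0 h0U).hasFPowerSeriesAt
  have pν := (aν 0 h0U).hasFPowerSeriesAt
  simp only [hder] at pμ
  have hev : complexMGF Y μ =ᶠ[𝓝 0] complexMGF Y ν := by
    have := pμ.sub pν
    rw [sub_self] at this
    filter_upwards [this.eventually_eq_zero] with w hw
    exact sub_eq_zero.1 hw
  exact aμ.eqOn_of_preconnected_of_eventuallyEq aν hU h0U hev (hmem z hz)

variable {n : ℕ} {L : MvPolynomial (Fin n) ℝ →ₗ[ℝ] ℝ} {ρ : ℝ}

theorem ExpBdd.exists_bound_linear_pow (hL : ExpBdd L ρ) (c : Fin n → ℝ) :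
    ∃ A, ∀ k : ℕ, |L ((∑ i, C (c i) * X i) ^ k)| ≤
      A * (((∑ i, |c i|) * ρ) ^ k * k.factorial) := by
  obtain ⟨A, hA⟩ := hL.bound
  have hρ := hL.pos
  refine ⟨A, fun k => ?_⟩
  suffices H : ∀ k (α : Fin n →₀ ℕ),
      |L ((∑ i, C (c i) * X i) ^ k * monomial α 1)| ≤
        A * ((∑ i, |c i|) ^ k * (ρ ^ (k + α.degree) * (k + α.degree).factorial)) by
    have := H k 0
    simpa [mul_pow, mul_assoc] using this
  intro k
  induction k with
  | zero => intro α; simpa using hA α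
  | succ k ih =>
    intro α
    have e : (∑ i, C (c i) * X i : MvPolynomial (Fin n) ℝ) ^ (k + 1) * monomial α 1 =
        ∑ i, c i • ((∑ i, C (c i) * X i) ^ k * monomial (α + Finsupp.single i 1) 1) := by
      rw [pow_succ, mul_assoc, Finset.sum_mul, Finset.mul_sum]
      refine Finset.sum_congr rfl fun i _ => ?_
      rw [monomial_add_single, pow_one, smul_eq_C_mul]
      ring
    rw [e, map_sum]
    refine (Finset.abs_sum_le_sum_abs _ _).trans ?_
    calc ∑ i, |L (c i • ((∑ i, C (c i) * X i) ^ k * monomial (α + Finsupp.single i 1) 1))|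
        ≤ ∑ i, |c i| * (A * ((∑ i, |c i|) ^ k *
            (ρ ^ (k + 1 + α.degree) * (k + 1 + α.degree).factorial))) := by
          refine Finset.sum_le_sum fun i _ => ?_
          rw [map_smul, smul_eq_mul, abs_mul]
          refine mul_le_mul_of_nonneg_left ((ih _).trans_eq ?_) (abs_nonneg _)
          rw [map_add, Finsupp.degree_single, show k + (α.degree + 1) = k + 1 + α.degree by ring]
      _ = _ := by rw [← Finset.sum_mul, pow_succ]; ring

/-- A functional of factorial-exponential growth has at most one representing measure. -/
theorem ExpBdd.measure_eq (hL : ExpBdd L ρ) {μ ν : Measure (Fin n → ℝ)} [IsFiniteMeasure μ]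
    [IsFiniteMeasure ν] (hμ : ∀ q, Integrable (fun x => eval x q) μ ∧ ∫ x, eval x q ∂μ = L q)
    (hν : ∀ q, Integrable (fun x => eval x q) ν ∧ ∫ x, eval x q ∂ν = L q) : μ = ν := by
  refine Measure.ext_of_charFunDual (funext fun ℓ => ?_)
  rw [charFunDual_eq_charFun_map_one, charFunDual_eq_charFun_map_one,
    ← complexMGF_mul_I ℓ.continuous.measurable.aemeasurable,
    ← complexMGF_mul_I ℓ.continuous.measurable.aemeasurable]
  set c : Fin n → ℝ := fun i => ℓ (Pi.single i 1)
  have hev : ∀ (x : Fin n → ℝ) (k : ℕ), ℓ x ^ k = eval x ((∑ i, C (c i) * X i) ^ k) := by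
    intro x k
    rw [map_pow]
    congr 1
    conv_lhs => rw [pi_eq_sum_univ' x, map_sum]
    simp [c, map_sum, mul_comm]
  obtain ⟨A, hA⟩ := hL.exists_bound_linear_pow c
  have hρ := hL.pos
  have hA0 : 0 ≤ A := by simpa using (abs_nonneg _).trans (hA 0)
  refine complexMGF_eq_of_moment_eq (R := (∑ i, |c i| + 1) * ρ) (C := A)
    ℓ.continuous.measurable (fun k => ?_) (fun k => ?_) (fun k => ?_) (by positivity)
    (fun k => ?_) (by simp)
  · simpa only [hev] using (hμ _).1
  · simpa only [hev] using (hν _).1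
  · simp only [hev, (hμ _).2, (hν _).2]
  · simp only [hev, (hμ _).2]
    refine (le_abs_self _).trans ((hA k).trans ?_)
    gcongr
    linarith

end Determinacy

section Support

open MeasureTheory

variable {n : ℕ} {L : MvPolynomial (Fin n) ℝ →ₗ[ℝ] ℝ} {ρ : ℝ}

/-- The measure `μ` has the values of `L` as its moments. -/
structure Represents (μ : Measure (Fin n → ℝ)) (L : MvPolynomial (Fin n) ℝ →ₗ[ℝ] ℝ) : Prop where
  finite : IsFiniteMeasure μ
  moments : ∀ q, Integrable (fun x => eval x q) μ ∧ ∫ x, eval x q ∂μ = L q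

theorem ExpBdd.exists_represents (hb : ExpBdd L ρ) (hL : ∀ p, 0 ≤ L (p ^ 2)) :
    ∃ μ, Represents μ L := by
  obtain ⟨μ, hfin, hμ⟩ := exists_measure_of_nonneg L (hb.nonneg_of_eval_nonneg hL)
  exact ⟨μ, hfin, hμ⟩

theorem measurable_eval (q : MvPolynomial (Fin n) ℝ) :
    Measurable fun x : Fin n → ℝ => eval x q :=
  q.continuous_eval.measurable

theorem Represents.withDensity {μ : Measure (Fin n → ℝ)} (hμ : Represents μ L)
    {r : MvPolynomial (Fin n) ℝ} (hr : ∀ x, 0 ≤ eval x r) :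
    Represents (μ.withDensity fun x => ENNReal.ofReal (eval x r)) (mulFunctional L r) := by
  have hm := (measurable_eval r).ennreal_ofReal
  refine ⟨isFiniteMeasure_withDensity_ofReal (hμ.moments r).1.2, fun q => ⟨?_, ?_⟩⟩
  · rw [integrable_withDensity_iff_integrable_smul' hm (.of_forall fun x => ENNReal.ofReal_lt_top)]
    simpa [ENNReal.toReal_ofReal (hr _)] using (hμ.moments (r * q)).1
  · rw [integral_withDensity_eq_integral_toReal_smul hm
      (.of_forall fun x => ENNReal.ofReal_lt_top)]
    simpa [ENNReal.toReal_ofReal (hr _)] using (hμ.moments (r * q)).2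

/-- A representing measure is concentrated where `g` is nonnegative, if the functional is
nonnegative on `g` times squares. -/
theorem ExpBdd.measure_eval_neg (hb : ExpBdd L ρ) {μ : Measure (Fin n → ℝ)}
    (hμ : Represents μ L) {g : MvPolynomial (Fin n) ℝ} (hg : ∀ p, 0 ≤ L (g * p ^ 2)) :
    μ {x | eval x g < 0} = 0 := by
  obtain ⟨ν, hν⟩ := (hb.mulFunctional g).exists_represents hg
  have := hμ.finite
  have := hν.finite
  have hα := hμ.withDensity (r := (1 + g) ^ 2) fun x => by rw [map_pow]; positivity
  have hβ := hμ.withDensity (r := (1 - g) ^ 2) fun x => by rw [map_pow]; positivity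
  set α := μ.withDensity fun x => ENNReal.ofReal (eval x ((1 + g) ^ 2)) with hα'
  set β := μ.withDensity fun x => ENNReal.ofReal (eval x ((1 - g) ^ 2)) with hβ'
  have := hα.finite
  have := hβ.finite
  have : IsFiniteMeasure ((4 : ENNReal) • ν) := Measure.smul_finite ν (by simp)
  have hν4 : ∀ q, Integrable (fun x => eval x q) ((4 : ENNReal) • ν) := fun q =>
    (hν.moments q).1.smul_measure (by simp)
  have hαβ : α = β + (4 : ENNReal) • ν := by
    refine (hb.mulFunctional ((1 + g) ^ 2)).measure_eq hα.moments fun q =>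
      ⟨(hβ.moments q).1.add_measure (hν4 q), ?_⟩
    rw [integral_add_measure (hβ.moments q).1 (hν4 q), integral_smul_measure,
      (hβ.moments q).2, (hν.moments q).2]
    simp only [mulFunctional_apply]
    rw [← map_smul, ← map_add]
    congr 1
    simp only [ENNReal.toReal_ofNat, smul_eq_C_mul, map_ofNat]
    ring
  set A : Set (Fin n → ℝ) := {x | eval x g < 0}
  have hA : MeasurableSet A := measurableSet_lt (measurable_eval g) measurable_const
  by_contra h0
  have hlt : α A < β A := by
    rw [hα', hβ', withDensity_apply _ hA, withDensity_apply _ hA]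
    refine setLIntegral_strict_mono hA h0 (measurable_eval _).ennreal_ofReal ?_
      (.of_forall fun x hx => ?_)
    · rw [← withDensity_apply _ hA]
      exact measure_ne_top α A
    · have hx : eval x g < 0 := hx
      simp only [map_pow, map_add, map_sub, map_one]
      rw [ENNReal.ofReal_lt_ofReal_iff (by nlinarith)]
      nlinarith
  rw [hαβ, Measure.add_apply] at hlt
  exact absurd hlt (not_lt.2 le_self_add)

/-- A functional of factorial-exponential growth that is nonnegative on a quadratic module is
nonnegative on the polynomials that are nonnegative on the associated set. -/
theorem ExpBdd.nonneg_of_eval_nonneg_of_localizing (hb : ExpBdd L ρ) (hL : ∀ p, 0 ≤ L (p ^ 2))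
    {ι : Type*} [Countable ι] {g : ι → MvPolynomial (Fin n) ℝ}
    (hg : ∀ j p, 0 ≤ L (g j * p ^ 2)) {f : MvPolynomial (Fin n) ℝ}
    (hf : ∀ x, (∀ j, 0 ≤ eval x (g j)) → 0 ≤ eval x f) : 0 ≤ L f := by
  obtain ⟨μ, hμ⟩ := hb.exists_represents hL
  rw [← (hμ.moments f).2]
  refine integral_nonneg_of_ae ?_
  have : ∀ᵐ x ∂μ, ∀ j, 0 ≤ eval x (g j) := ae_all_iff.2 fun j => by
    rw [ae_iff]
    simpa using hb.measure_eval_neg hμ (hg j)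
  filter_upwards [this] with x hx using hf x hx

end Support

section WeightedNorm

variable {n : ℕ}

theorem wnorm_eq_sum_of_subset {f : MvPolynomial (Fin n) ℝ} {s : Finset (Fin n →₀ ℕ)}
    (hs : f.support ⊆ s) : wnorm f = ∑ α ∈ s, (wt α : ℝ) * |f.coeff α| :=
  Finset.sum_subset hs fun α _ hα => by rw [notMem_support_iff.1 hα]; simp

theorem wnorm_nonneg (f : MvPolynomial (Fin n) ℝ) : 0 ≤ wnorm f :=
  Finset.sum_nonneg fun _ _ => by positivity

theorem wnorm_zero : wnorm (0 : MvPolynomial (Fin n) ℝ) = 0 := by simp [wnorm]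

theorem wnorm_add_le (p q : MvPolynomial (Fin n) ℝ) : wnorm (p + q) ≤ wnorm p + wnorm q := by
  classical
  rw [wnorm_eq_sum_of_subset (support_add (p := p) (q := q)),
    wnorm_eq_sum_of_subset (Finset.subset_union_left (s₁ := p.support) (s₂ := q.support)),
    wnorm_eq_sum_of_subset (Finset.subset_union_right (s₁ := p.support) (s₂ := q.support)),
    ← Finset.sum_add_distrib]
  refine Finset.sum_le_sum fun α _ => ?_
  rw [← mul_add, coeff_add]
  exact mul_le_mul_of_nonneg_left (abs_add_le _ _) (Nat.cast_nonneg _)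

theorem wnorm_smul (c : ℝ) (f : MvPolynomial (Fin n) ℝ) : wnorm (c • f) = |c| * wnorm f := by
  rw [wnorm_eq_sum_of_subset (support_smul (a := c) (f := f)), wnorm, Finset.mul_sum]
  refine Finset.sum_congr rfl fun α _ => ?_
  rw [coeff_smul, smul_eq_mul, abs_mul]
  ring

theorem wnorm_neg (f : MvPolynomial (Fin n) ℝ) : wnorm (-f) = wnorm f := by
  rw [← neg_one_smul ℝ f, wnorm_smul]; simp

theorem wnorm_monomial_one (α : Fin n →₀ ℕ) :
    wnorm (monomial α 1 : MvPolynomial (Fin n) ℝ) = wt α := by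
  rw [wnorm_eq_sum_of_subset support_monomial_subset]; simp

theorem wt_eq (α : Fin n →₀ ℕ) : wt α = (2 * ((α.degree + 1) / 2)).factorial := rfl

theorem wt_le (α : Fin n →₀ ℕ) : wt α ≤ 2 ^ α.degree * α.degree.factorial := by
  rw [wt_eq]
  calc (2 * ((α.degree + 1) / 2)).factorial ≤ (α.degree + 1).factorial :=
        Nat.factorial_le (by lia)
    _ = (α.degree + 1) * α.degree.factorial := Nat.factorial_succ _
    _ ≤ _ := Nat.mul_le_mul_right _ Nat.lt_two_pow_self

theorem factorial_degree_le_wt (α : Fin n →₀ ℕ) : α.degree.factorial ≤ wt α := by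
  rw [wt_eq]
  exact Nat.factorial_le (by lia)

theorem expBdd_of_abs_le_wnorm {L : MvPolynomial (Fin n) ℝ →ₗ[ℝ] ℝ}
    (hL : ∀ p, |L p| ≤ wnorm p) : ExpBdd L 2 := by
  refine ⟨two_pos, 1, fun α => (hL _).trans ?_⟩
  rw [wnorm_monomial_one, one_mul]
  exact_mod_cast wt_le α

/-- Separation of a point from the `w`-closure of a convex cone. -/
theorem exists_linearMap_of_le_wnorm_sub {Q : Set (MvPolynomial (Fin n) ℝ)} (h0 : 0 ∈ Q)
    (hadd : ∀ p ∈ Q, ∀ q ∈ Q, p + q ∈ Q) (hsmul : ∀ c : ℝ, 0 < c → ∀ p ∈ Q, c • p ∈ Q)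
    {p₀ : MvPolynomial (Fin n) ℝ} {δ : ℝ} (hδ : 0 < δ) (hp₀ : ∀ h ∈ Q, δ ≤ wnorm (p₀ - h)) :
    ∃ L : MvPolynomial (Fin n) ℝ →ₗ[ℝ] ℝ,
      (∀ p, |L p| ≤ wnorm p) ∧ (∀ h ∈ Q, 0 ≤ L h) ∧ L p₀ < 0 := by
  have : Nonempty Q := ⟨⟨0, h0⟩⟩
  set N : MvPolynomial (Fin n) ℝ → ℝ := fun p => ⨅ h : Q, wnorm (p + (h : MvPolynomial (Fin n) ℝ))
  have hbdd : ∀ p, BddBelow (Set.range fun h : Q => wnorm (p + (h : MvPolynomial (Fin n) ℝ))) :=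
    fun p => ⟨0, by rintro _ ⟨h, rfl⟩; exact wnorm_nonneg _⟩
  have hN_le : ∀ p, ∀ h ∈ Q, N p ≤ wnorm (p + h) := fun p h hh => ciInf_le (hbdd p) ⟨h, hh⟩
  have hN0 : ∀ p, 0 ≤ N p := fun p => le_ciInf fun h => wnorm_nonneg _
  have hNsmul_le : ∀ c : ℝ, 0 < c → ∀ p, N (c • p) ≤ c * N p := by
    intro c hc p
    rw [Real.mul_iInf_of_nonneg hc.le]
    refine le_ciInf fun h => (hN_le _ _ (hsmul c hc h h.2)).trans_eq ?_
    rw [← smul_add, wnorm_smul, abs_of_pos hc]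
  have hNsmul : ∀ c : ℝ, 0 < c → ∀ p, N (c • p) = c * N p := by
    intro c hc p
    refine (hNsmul_le c hc p).antisymm ?_
    have := hNsmul_le c⁻¹ (inv_pos.2 hc) (c • p)
    rwa [inv_smul_smul₀ hc.ne', ← div_eq_inv_mul, le_div_iff₀' hc] at this
  have hNadd : ∀ p q, N (p + q) ≤ N p + N q := by
    intro p q
    refine le_ciInf_add_ciInf fun h k => (hN_le _ _ (hadd h h.2 k k.2)).trans ?_
    rw [add_add_add_comm]
    exact wnorm_add_le _ _
  have hNp : δ ≤ N (-p₀) := le_ciInf fun h => by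
    rw [← wnorm_neg, neg_add, neg_neg, ← sub_eq_add_neg]
    exact hp₀ h h.2
  have hne : -p₀ ≠ 0 := by
    intro h
    have := hp₀ 0 h0
    rw [neg_eq_zero.1 h, sub_zero, wnorm_zero] at this
    exact this.not_gt hδ
  obtain ⟨L, hLf, hLN⟩ := exists_extension_of_le_sublinear
    (LinearPMap.mkSpanSingleton (-p₀) (N (-p₀)) hne) N hNsmul hNadd (by
      rintro ⟨x, hx⟩
      obtain ⟨c, rfl⟩ := Submodule.mem_span_singleton.1 hx
      refine (LinearPMap.mkSpanSingleton'_apply _ _ _ c hx).trans_le ?_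
      change c * N (-p₀) ≤ N (c • -p₀)
      rcases lt_trichotomy c 0 with hc | rfl | hc
      · exact (mul_nonpos_of_nonpos_of_nonneg hc.le (hN0 _)).trans (hN0 _)
      · rw [zero_mul]; exact hN0 _
      · exact (hNsmul c hc _).ge)
  have hLw : ∀ p, L p ≤ wnorm p := fun p => (hLN p).trans (by simpa using hN_le p 0 h0)
  refine ⟨L, fun p => abs_le'.2 ⟨hLw p, ?_⟩, fun h hh => ?_, ?_⟩
  · rw [← map_neg, ← wnorm_neg p]
    exact hLw _
  · have := (hLN (-h)).trans (hN_le _ h hh)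
    rw [neg_add_cancel, wnorm_zero, map_neg] at this
    linarith
  · have := (hLf ⟨-p₀, Submodule.mem_span_singleton_self _⟩).trans
      (LinearPMap.mkSpanSingleton_apply ℝ _ hne _)
    rw [map_neg] at this
    linarith

theorem abs_eval_le_exp_mul_wnorm {x : Fin n → ℝ} {M : ℝ} (hx : ∀ i, |x i| ≤ M) (hM : 0 ≤ M)
    (q : MvPolynomial (Fin n) ℝ) : |eval x q| ≤ Real.exp M * wnorm q := by
  rw [eval_eq, wnorm, Finset.mul_sum]
  refine (Finset.abs_sum_le_sum_abs _ _).trans (Finset.sum_le_sum fun α _ => ?_)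
  rw [abs_mul, ← mul_assoc, mul_comm]
  refine mul_le_mul_of_nonneg_right ?_ (abs_nonneg _)
  calc |∏ i ∈ α.support, x i ^ α i| ≤ ∏ i ∈ α.support, M ^ α i := by
        rw [Finset.abs_prod]
        refine Finset.prod_le_prod (fun _ _ => abs_nonneg _) fun i _ => ?_
        rw [abs_pow]
        exact pow_le_pow_left₀ (abs_nonneg _) (hx i) _
    _ = M ^ α.degree := by rw [Finset.prod_pow_eq_pow_sum]; rfl
    _ ≤ Real.exp M * α.degree.factorial :=
        (div_le_iff₀ (by positivity)).1 (Real.pow_div_factorial_le_exp M hM _)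
    _ ≤ Real.exp M * wt α := by
        gcongr
        exact factorial_degree_le_wt α

end WeightedNorm

section QuadraticModule

variable {n m : ℕ}

theorem IsSOS.zero : IsSOS (0 : MvPolynomial (Fin n) ℝ) := ⟨0, 0, by simp⟩

theorem IsSOS.sq (p : MvPolynomial (Fin n) ℝ) : IsSOS (p ^ 2) := ⟨1, fun _ => p, by simp⟩

theorem IsSOS.add {σ τ : MvPolynomial (Fin n) ℝ} (hσ : IsSOS σ) (hτ : IsSOS τ) :
    IsSOS (σ + τ) := by
  obtain ⟨k, p, rfl⟩ := hσ
  obtain ⟨l, q, rfl⟩ := hτ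
  exact ⟨k + l, Fin.append p q, by simp [Fin.sum_univ_add]⟩

theorem IsSOS.smul {σ : MvPolynomial (Fin n) ℝ} (hσ : IsSOS σ) {c : ℝ} (hc : 0 ≤ c) :
    IsSOS (c • σ) := by
  obtain ⟨k, p, rfl⟩ := hσ
  refine ⟨k, fun i => √c • p i, ?_⟩
  rw [Finset.smul_sum]
  exact Finset.sum_congr rfl fun i _ => by rw [smul_pow, Real.sq_sqrt hc]

theorem IsSOS.eval_nonneg {σ : MvPolynomial (Fin n) ℝ} (hσ : IsSOS σ) (x : Fin n → ℝ) :
    0 ≤ eval x σ := by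
  obtain ⟨k, p, rfl⟩ := hσ
  rw [map_sum]
  exact Finset.sum_nonneg fun i _ => by rw [map_pow]; positivity

variable {g : Fin m → MvPolynomial (Fin n) ℝ}

theorem memQM_of_isSOS {σ : MvPolynomial (Fin n) ℝ} (hσ : IsSOS σ) : memQM g σ :=
  ⟨σ, 0, hσ, fun _ => IsSOS.zero, by simp⟩

theorem memQM_mul_sq (j : Fin m) (p : MvPolynomial (Fin n) ℝ) : memQM g (g j * p ^ 2) := by
  refine ⟨0, Pi.single j (p ^ 2), IsSOS.zero, fun i => ?_, ?_⟩
  · obtain rfl | h := eq_or_ne i j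
    · simpa using IsSOS.sq p
    · simpa [h] using IsSOS.zero
  · rw [Finset.sum_eq_single j (fun i _ h => by simp [h]) (by simp)]
    simp [mul_comm]

theorem memQM.add {p q : MvPolynomial (Fin n) ℝ} (hp : memQM g p) (hq : memQM g q) :
    memQM g (p + q) := by
  obtain ⟨σ₀, σ, h₀, h, rfl⟩ := hp
  obtain ⟨τ₀, τ, h₀', h', rfl⟩ := hq
  refine ⟨σ₀ + τ₀, σ + τ, h₀.add h₀', fun j => (h j).add (h' j), ?_⟩
  simp only [Pi.add_apply, add_mul, Finset.sum_add_distrib]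
  ring

theorem memQM.smul {p : MvPolynomial (Fin n) ℝ} (hp : memQM g p) {c : ℝ} (hc : 0 ≤ c) :
    memQM g (c • p) := by
  obtain ⟨σ₀, σ, h₀, h, rfl⟩ := hp
  refine ⟨c • σ₀, c • σ, h₀.smul hc, fun j => (h j).smul hc, ?_⟩
  simp [smul_add, Finset.smul_sum]

theorem memQM.eval_nonneg {p : MvPolynomial (Fin n) ℝ} (hp : memQM g p) {x : Fin n → ℝ}
    (hx : ∀ j, 0 ≤ eval x (g j)) : 0 ≤ eval x p := by
  obtain ⟨σ₀, σ, h₀, h, rfl⟩ := hp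
  simp only [map_add, map_sum, map_mul]
  exact add_nonneg (h₀.eval_nonneg x)
    (Finset.sum_nonneg fun j _ => mul_nonneg ((h j).eval_nonneg x) (hx j))

/-- Polynomials that are nonnegative on the set defined by `g` lie in the `w`-closure of the
quadratic module of `g`. -/
theorem exists_memQM_wnorm_sub_lt {p : MvPolynomial (Fin n) ℝ}
    (hp : ∀ x, (∀ j, 0 ≤ eval x (g j)) → 0 ≤ eval x p) {δ : ℝ} (hδ : 0 < δ) :
    ∃ h, memQM g h ∧ wnorm (p - h) < δ := by
  by_contra! hcon
  obtain ⟨L, hLw, hLQ, hLp⟩ := exists_linearMap_of_le_wnorm_sub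
    (Q := {h | memQM g h}) (memQM_of_isSOS IsSOS.zero) (fun _ hp _ hq => memQM.add hp hq)
    (fun _ hc _ hp => memQM.smul hp hc.le) hδ hcon
  exact hLp.not_ge ((expBdd_of_abs_le_wnorm hLw).nonneg_of_eval_nonneg_of_localizing
    (fun q => hLQ _ (memQM_of_isSOS (IsSOS.sq q))) (fun j q => hLQ _ (memQM_mul_sq j q)) hp)

theorem eval_nonneg_of_forall_exists_memQM {p : MvPolynomial (Fin n) ℝ}
    (hp : ∀ δ : ℝ, 0 < δ → ∃ h, memQM g h ∧ wnorm (p - h) < δ) {x : Fin n → ℝ}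
    (hx : ∀ j, 0 ≤ eval x (g j)) : 0 ≤ eval x p := by
  set M := ∑ i, |x i|
  have hxM : ∀ i, |x i| ≤ M := fun i =>
    Finset.single_le_sum (f := fun i => |x i|) (fun _ _ => abs_nonneg _) (Finset.mem_univ i)
  refine le_of_forall_pos_le_add fun η hη => ?_
  obtain ⟨h, hh, hlt⟩ := hp (η / Real.exp M) (by positivity)
  have h₁ := abs_eval_le_exp_mul_wnorm hxM (by positivity) (p - h)
  have h₂ := hh.eval_nonneg hx
  rw [lt_div_iff₀' (Real.exp_pos M)] at hlt
  rw [map_sub] at h₁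
  linarith [neg_abs_le (eval x p - eval x h)]

theorem eval_pert_le (d : ℕ) (x : Fin n → ℝ) :
    eval x (pert n d) ≤ 1 + ∑ i, Real.cosh (x i) := by
  simp only [pert, map_add, map_one, map_sum, map_mul, map_pow, eval_C, eval_X]
  gcongr with i
  simp only [inv_mul_eq_div]
  refine sum_le_hasSum _ (fun k _ => ?_) (Real.hasSum_cosh (x i))
  rw [pow_mul]
  positivity

end QuadraticModule

theorem stmt12 {n m : ℕ} (g : Fin m → MvPolynomial (Fin n) ℝ)
    (K : Set (Fin n → ℝ)) (hK : K = {x | ∀ j, 0 ≤ eval x (g j)})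
    (hint : (interior K).Nonempty) (f : MvPolynomial (Fin n) ℝ) :
    (∀ x ∈ K, 0 ≤ eval x f) ↔
      ∀ ε : ℝ, 0 < ε → ∃ d : ℕ,
        ∀ δ : ℝ, 0 < δ → ∃ h, memQM g h ∧
          wnorm (f + C ε * pert n d - h) < δ := by
  subst hK
  constructor
  · refine fun hf ε hε => ⟨0, fun δ hδ => exists_memQM_wnorm_sub_lt (fun x hx => ?_) hδ⟩
    have := hf x hx
    have h₁ : eval x (f + C ε * pert n 0) = eval x f + ε := by simp [pert]
    rw [h₁]
    positivity
  · intro H x hx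
    set B := 1 + ∑ i, Real.cosh (x i)
    have hB : 0 < B :=
      add_pos_of_pos_of_nonneg one_pos (Finset.sum_nonneg fun i _ => (Real.cosh_pos _).le)
    refine le_of_forall_pos_le_add fun η hη => ?_
    obtain ⟨d, hd⟩ := H (η / B) (by positivity)
    have h₁ := eval_nonneg_of_forall_exists_memQM hd hx
    have h₂ : η / B * eval x (pert n d) ≤ η / B * B := by
      gcongr
      exact eval_pert_le d x
    rw [div_mul_cancel₀ _ hB.ne'] at h₂
    simp only [map_add, map_mul, eval_C] at h₁
    linarith
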